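/- Let S = (Γ,Σ,#,Δ) be a tiling system with square pictures, i.e. there exists c ∈ ℕ such that for every word w ∈ L(S) there is an (n,m)-picture p ∈ P(S) with fr(p) = w and n ≤ c·m. Then there exist a synchronized rational graph H of finite out-degree, a single vertex i, and a rational set F such that L(H,{i},F) = L(S). -/

import Mathlib

/-!  Common definitions: transducers, rational graphs, regular languages,
pictures and tiling systems, following Carayol & Meyer,
"Context-Sensitive Languages, Rational Graphs and Determinism". -/

/-- A set of words is regular (rational) if it is recognized by a finite automaton. -/
def Regular {Γ : Type} (L : Set (List Γ)) : Prop :=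
  ∃ (Q : Type) (_ : Fintype Q) (M : DFA Γ Q), M.accepts = L

/-- A finite transducer over the alphabet `Γ`: a finite automaton whose
transitions are labeled by pairs in `(Γ ∪ {ε}) × (Γ ∪ {ε})`,
where `none` encodes the empty word ε. -/
structure Transducer (Γ : Type) where
  /-- states -/
  Q : Type
  /-- the set of states is finite -/
  fintypeQ : Fintype Q
  /-- initial state -/
  init : Q
  /-- final states -/
  final : Set Q
  /-- transition relation -/
  trans : Q → Option Γ × Option Γ → Q → Prop

namespace Transducer

variable {Γ : Type}

/-- Paths in a transducer, recording the list of transition labels. -/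
inductive Path (T : Transducer Γ) : T.Q → List (Option Γ × Option Γ) → T.Q → Prop
  | nil (q : T.Q) : Path T q [] q
  | cons {q q' q'' : T.Q} {l : Option Γ × Option Γ} {ls : List (Option Γ × Option Γ)} :
      T.trans q l q' → Path T q' ls q'' → Path T q (l :: ls) q''

/-- Input word of a list of transition labels (concatenation of first components). -/
def ins (ls : List (Option Γ × Option Γ)) : List Γ := ls.flatMap fun l => l.1.toList

/-- Output word of a list of transition labels (concatenation of second components). -/
def outs (ls : List (Option Γ × Option Γ)) : List Γ := ls.flatMap fun l => l.2.toList

/-- The binary relation on `Γ*` recognized by the transducer: pairs `(u,v)`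
obtained by concatenating componentwise the labels along an accepting run. -/
def Accepts (T : Transducer Γ) (u v : List Γ) : Prop :=
  ∃ (q : T.Q) (ls : List (Option Γ × Option Γ)),
    T.Path T.init ls q ∧ q ∈ T.final ∧ ins ls = u ∧ outs ls = v

/-- A transducer is synchronous if all its transitions are labeled by pairs
of letters of `Γ` (no ε). -/
def Synchronous (T : Transducer Γ) : Prop :=
  ∀ (q q' : T.Q) (l : Option Γ × Option Γ), T.trans q l q' → l.1.isSome ∧ l.2.isSome

/-- A transducer is (left-)synchronized if every path from the initial state
consists of a prefix of transitions labeled by pairs of letters of `Γ`,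
followed by transitions which are all ε on the input side, or all ε on the
output side. -/
def Synchronized (T : Transducer Γ) : Prop :=
  ∀ (q : T.Q) (ls : List (Option Γ × Option Γ)), T.Path T.init ls q →
    ∃ k : ℕ, (∀ l ∈ ls.take k, l.1.isSome ∧ l.2.isSome) ∧
      ((∀ l ∈ ls.drop k, l.1 = none) ∨ (∀ l ∈ ls.drop k, l.2 = none))

/-- A transducer is sequential if for any two transitions from a common state,
either they coincide, or their input letters are distinct letters of `Γ`. -/
def Sequential (T : Transducer Γ) : Prop :=
  ∀ (q q' q'' : T.Q) (x y x' y' : Option Γ),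
    T.trans q (x, y) q' → T.trans q (x', y') q'' →
    (x = x' ∧ y = y' ∧ q' = q'') ∨ (x ≠ none ∧ x' ≠ none ∧ x ≠ x')

/-- A transducer is deterministic if no two distinct transitions from the same
state carry the same label. -/
def Deterministic (T : Transducer Γ) : Prop :=
  ∀ (q q' q'' : T.Q) (l : Option Γ × Option Γ),
    T.trans q l q' → T.trans q l q'' → q' = q''

end Transducer

/-- A rational graph labeled by the alphabet `A` with vertices in `Γ*`,
given by one transducer over `Γ` per label. -/
structure RationalGraph (A Γ : Type) where
  /-- the transducer defining the edges labeled by a given letter -/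
  trans : A → Transducer Γ

namespace RationalGraph

variable {A Γ : Type}

/-- There is an edge `u →a v` iff `(u,v)` is recognized by the transducer `T_a`. -/
def Edge (G : RationalGraph A Γ) (u : List Γ) (a : A) (v : List Γ) : Prop :=
  (G.trans a).Accepts u v

/-- A synchronous rational graph is defined by synchronous transducers. -/
def Synchronous (G : RationalGraph A Γ) : Prop := ∀ a : A, (G.trans a).Synchronous

/-- A synchronized rational graph is defined by synchronized transducers. -/
def Synchronized (G : RationalGraph A Γ) : Prop := ∀ a : A, (G.trans a).Synchronized

/-- A sequential rational graph is defined by sequential transducers. -/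
def Sequential (G : RationalGraph A Γ) : Prop := ∀ a : A, (G.trans a).Sequential

/-- `vs` is the sequence of vertices of a path labeled by the word `w`. -/
def IsPath (G : RationalGraph A Γ) (vs : List (List Γ)) (w : List A) : Prop :=
  vs.length = w.length + 1 ∧
  ∀ (k : ℕ) (a : A) (u v : List Γ),
    w[k]? = some a → vs[k]? = some u → vs[k + 1]? = some v → G.Edge u a v

/-- The path language of `G` between the sets of vertices `I` and `F`:
all words labeling a path from a vertex of `I` to a vertex of `F`. -/
def Lang (G : RationalGraph A Γ) (I F : Set (List Γ)) : Set (List A) :=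
  { w | ∃ (vs : List (List Γ)) (i f : List Γ), G.IsPath vs w ∧
      vs.head? = some i ∧ i ∈ I ∧ vs.getLast? = some f ∧ f ∈ F }

/-- A graph has finite out-degree if every vertex has finitely many outgoing edges. -/
def FiniteOutDegree (G : RationalGraph A Γ) : Prop :=
  ∀ u : List Γ, { p : A × List Γ | G.Edge u p.1 p.2 }.Finite

/-- The out-degree of a vertex: the number of its outgoing edges. -/
noncomputable def outDegree (G : RationalGraph A Γ) (u : List Γ) : ℕ :=
  { p : A × List Γ | G.Edge u p.1 p.2 }.ncard

/-- Two vertices are adjacent if some edge (in either direction, ignoring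
labels) connects them. -/
def Adj (G : RationalGraph A Γ) (u v : List Γ) : Prop :=
  (∃ a, G.Edge u a v) ∨ (∃ a, G.Edge v a u)

end RationalGraph

/-- `chainN R n u v` holds iff there is a sequence of `n` `R`-steps from `u` to `v`. -/
def chainN {α : Type} (R : α → α → Prop) : ℕ → α → α → Prop
  | 0, u, v => u = v
  | n + 1, u, w => ∃ v, R u v ∧ chainN R n v w

/-- `IsDist R x v n` : the length of a shortest `R`-sequence from `x` to `v` is `n`. -/
def IsDist {α : Type} (R : α → α → Prop) (x v : α) (n : ℕ) : Prop :=
  chainN R n x v ∧ ∀ m : ℕ, chainN R m x v → n ≤ m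

/-- A 2×2 tile over the alphabet `Λ`. -/
structure Tile (Λ : Type) where
  /-- top-left letter -/
  tl : Λ
  /-- top-right letter -/
  tr : Λ
  /-- bottom-left letter -/
  bl : Λ
  /-- bottom-right letter -/
  br : Λ

/-- The set of 2×2 tiles appearing in a picture given as a list of rows. -/
def tilesOf {Λ : Type} (rows : List (List Λ)) : Set (Tile Λ) :=
  { t | ∃ (i j : ℕ) (r₁ r₂ : List Λ), rows[i]? = some r₁ ∧ rows[i + 1]? = some r₂ ∧
      r₁[j]? = some t.tl ∧ r₁[j + 1]? = some t.tr ∧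
      r₂[j]? = some t.bl ∧ r₂[j + 1]? = some t.br }

/-- The picture of width `m` framed by the border symbol `#` (encoded by `none`). -/
def framed {Λ : Type} (rows : List (List Λ)) (m : ℕ) : List (List (Option Λ)) :=
  List.replicate (m + 2) none ::
    (rows.map fun r => none :: (r.map some ++ [none])) ++
      [List.replicate (m + 2) none]

/-- A tiling system with input alphabet `A` and work alphabet `Λ`
(the frame symbol `#` is encoded by `none : Option Λ`). -/
structure TilingSystem (A Λ : Type) where
  /-- the embedding of the input alphabet into the work alphabet -/
  emb : A → Λ
  /-- the input alphabet is a sub-alphabet of the work alphabet -/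
  emb_inj : Function.Injective emb
  /-- the (finite, as `Λ` is finite) set of allowed tiles over `Λ ∪ {#}` -/
  tiles : Set (Tile (Option Λ))

namespace TilingSystem

variable {A Λ : Type}

/-- `S.Pic rows n m` : `rows` is an `(n,m)`-picture of the picture language of `S`,
i.e. all 2×2 tiles of the framed picture belong to the tiles of `S`. -/
def Pic (S : TilingSystem A Λ) (rows : List (List Λ)) (n m : ℕ) : Prop :=
  0 < n ∧ 0 < m ∧ rows.length = n ∧ (∀ r ∈ rows, r.length = m) ∧
    tilesOf (framed rows m) ⊆ S.tiles

/-- The word language of a tiling system: frontiers (first rows) of accepted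
pictures that are words over the input alphabet. -/
def Lang (S : TilingSystem A Λ) : Set (List A) :=
  { w | ∃ (rows : List (List Λ)) (n : ℕ),
      S.Pic rows n w.length ∧ rows.head? = some (w.map S.emb) }

/-- A tiling system is deterministic if each row determines at most one
possible next row. -/
def Deterministic (S : TilingSystem A Λ) : Prop :=
  ∀ u v v' : List (Option Λ), v.length = u.length → v'.length = u.length →
    tilesOf [none :: u ++ [none], none :: v ++ [none]] ⊆ S.tiles →
    tilesOf [none :: u ++ [none], none :: v' ++ [none]] ⊆ S.tiles → v = v'

end TilingSystem

theorem Transducer.path_nil_inv {Γ : Type} {T : Transducer Γ} {q q' : T.Q}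
    (h : T.Path q [] q') : q = q' := by
  cases h; rfl

theorem Transducer.path_cons_inv {Γ : Type} {T : Transducer Γ} {q q'' : T.Q} {l ls}
    (h : T.Path q (l :: ls) q'') : ∃ q', T.trans q l q' ∧ T.Path q' ls q'' := by
  cases h with
  | cons h1 h2 => exact ⟨_, h1, h2⟩

/-- A domino system (work alphabet `B`, input alphabet `A`). -/
structure Dom (A B : Type) where
  H : B → B → Prop
  V : B → B → Prop
  L : B → Prop
  R : B → Prop
  Bot : B → Prop
  Top : A → B → Prop

namespace Dom

variable {A B : Type}

/-- Square pictures recognized by a domino system. -/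
def Lang (D : Dom A B) : Set (List A) :=
  { w | 0 < w.length ∧ ∃ g : ℕ → ℕ → B,
      (∀ i j, i < w.length → j + 1 < w.length → D.H (g i j) (g i (j + 1))) ∧
      (∀ i j, i + 1 < w.length → j < w.length → D.V (g i j) (g (i + 1) j)) ∧
      (∀ i, i < w.length → D.L (g i 0)) ∧
      (∀ i, i < w.length → D.R (g i (w.length - 1))) ∧
      (∀ j, j < w.length → D.Bot (g (w.length - 1) j)) ∧
      (∀ j a, w[j]? = some a → D.Top a (g 0 j)) }

/-- Condition on consecutive letters of a vertex. -/
def ok (D : Dom A B) (a : A) : Option (B × B) → B × B → Prop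
  | none, y => D.Top a y.1 ∧ D.L y.2
  | some p, y => D.V p.1 y.1 ∧ D.H p.2 y.2

/-- Transition relation; the state `none` is the final state. -/
def tr (D : Dom A B) (a : A) : Option (Option (B × B)) →
    Option (B × B) × Option (B × B) → Option (Option (B × B)) → Prop
  | some p, (some x, some y), q => q = some (some y) ∧ D.ok a p y ∧ D.H x.1 y.1 ∧ D.V x.2 y.2
  | some p, (none, some y), q => q = none ∧ D.ok a p y ∧ y.1 = y.2
  | _, _, _ => False

def T [Fintype B] (D : Dom A B) (a : A) : Transducer (B × B) where
  Q := Option (Option (B × B))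
  fintypeQ := inferInstance
  init := some none
  final := {none}
  trans := D.tr a

/-- Recursive description of accepted pairs. -/
def Run (D : Dom A B) (a : A) : Option (B × B) → List (B × B) → List (B × B) → Prop
  | p, [], [y] => D.ok a p y ∧ y.1 = y.2
  | p, x :: u, y :: v => D.ok a p y ∧ D.H x.1 y.1 ∧ D.V x.2 y.2 ∧ Run D a (some y) u v
  | _, _, _ => False

theorem path_none [Fintype B] (D : Dom A B) (a : A) {ls q}
    (h : (D.T a).Path (none : Option (Option (B × B))) ls q) : ls = [] ∧ q = none := by
  cases ls with
  | nil => exact ⟨rfl, (Transducer.path_nil_inv h).symm⟩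
  | cons l ls =>
    obtain ⟨q', h, _⟩ := Transducer.path_cons_inv h
    exact absurd h (by simp [T, tr])

theorem run_of_path [Fintype B] (D : Dom A B) (a : A) (ls) : ∀ (p : Option (B × B)),
    (D.T a).Path (some p : Option (Option (B × B))) ls (none : Option (Option (B × B))) →
    D.Run a p (Transducer.ins ls) (Transducer.outs ls) := by
  induction ls with
  | nil => intro p h; cases Transducer.path_nil_inv h
  | cons l ls ih =>
    intro p h
    obtain ⟨q1, h1, h2⟩ := Transducer.path_cons_inv h
    rcases l with ⟨_ | x, _ | y⟩
    · exact absurd h1 (by simp [T, tr])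
    · obtain ⟨rfl, h3, h4⟩ := h1
      obtain ⟨rfl, _⟩ := D.path_none a h2
      exact ⟨h3, h4⟩
    · exact absurd h1 (by simp [T, tr])
    · obtain ⟨rfl, h3, h4, h5⟩ := h1
      exact ⟨h3, h4, h5, ih _ h2⟩

theorem path_of_run [Fintype B] (D : Dom A B) (a : A) (u : List (B × B)) : ∀ p v,
    D.Run a p u v → ∃ ls, (D.T a).Path (some p : Option (Option (B × B))) ls
      (none : Option (Option (B × B))) ∧ Transducer.ins ls = u ∧ Transducer.outs ls = v := by
  induction u with
  | nil =>
    intro p v h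
    match v, h with
    | [y], h =>
      refine ⟨[(none, some y)], .cons (q' := (none : Option (Option (B × B)))) ?_ (.nil _), rfl, rfl⟩
      exact ⟨rfl, h⟩
  | cons x u ih =>
    intro p v h
    match v, h with
    | y :: v, ⟨h1, h2, h3, h4⟩ =>
      obtain ⟨ls, h5, rfl, rfl⟩ := ih _ _ h4
      exact ⟨(some x, some y) :: ls, .cons (q' := (some (some y) : Option (Option (B × B))))
        ⟨rfl, h1, h2, h3⟩ h5, rfl, rfl⟩

theorem accepts_iff [Fintype B] (D : Dom A B) (a : A) (u v : List (B × B)) :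
    (D.T a).Accepts u v ↔ D.Run a none u v := by
  constructor
  · rintro ⟨q, ls, h, hq, rfl, rfl⟩
    have : q = (none : Option (Option (B × B))) := hq
    subst this
    exact D.run_of_path a ls none h
  · intro h
    obtain ⟨ls, h1, h2, h3⟩ := D.path_of_run a u none v h
    exact ⟨(none : Option (Option (B × B))), ls, h1, rfl, h2, h3⟩

theorem sync_aux [Fintype B] (D : Dom A B) (a : A) (ls) : ∀ (p : Option (B × B)) q,
    (D.T a).Path (some p : Option (Option (B × B))) ls q →
    ∃ k : ℕ, (∀ l ∈ ls.take k, l.1.isSome ∧ l.2.isSome) ∧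
      ((∀ l ∈ ls.drop k, l.1 = none) ∨ (∀ l ∈ ls.drop k, l.2 = none)) := by
  induction ls with
  | nil => intro p q _; exact ⟨0, by simp⟩
  | cons l ls ih =>
    intro p q h
    obtain ⟨q1, h1, h2⟩ := Transducer.path_cons_inv h
    rcases l with ⟨_ | x, _ | y⟩
    · exact absurd h1 (by simp [T, tr])
    · obtain ⟨rfl, h3, h4⟩ := h1
      obtain ⟨rfl, _⟩ := D.path_none a h2
      exact ⟨0, by simp⟩
    · exact absurd h1 (by simp [T, tr])
    · obtain ⟨rfl, h3, h4, h5⟩ := h1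
      obtain ⟨k, h6, h7⟩ := ih _ _ h2
      refine ⟨k + 1, ?_, by simpa using h7⟩
      intro l hl
      rw [List.take_succ_cons, List.mem_cons] at hl
      rcases hl with rfl | hl
      · simp
      · exact h6 l hl

/-- Index description of `Run`. -/
theorem run_iff (D : Dom A B) (a : A) (u : List (B × B)) : ∀ p v,
    D.Run a p u v ↔ v.length = u.length + 1 ∧ (∀ y, v[0]? = some y → D.ok a p y) ∧
      (∀ (i : ℕ) (y y' : B × B), v[i]? = some y → v[i + 1]? = some y' → D.V y.1 y'.1 ∧ D.H y.2 y'.2) ∧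
      (∀ (i : ℕ) (x y : B × B), u[i]? = some x → v[i]? = some y → D.H x.1 y.1 ∧ D.V x.2 y.2) ∧
      (∀ y, v[u.length]? = some y → y.1 = y.2) := by
  induction u with
  | nil =>
    intro p v
    match v with
    | [] => simp [Run]
    | [y] => simp [Run]
    | y :: z :: v => simp [Run]
  | cons x u ih =>
    intro p v
    match v with
    | [] => simp [Run]
    | y :: v =>
      simp only [Run, ih]
      constructor
      · rintro ⟨h1, h2, h3, h4, h5, h6, h7, h8⟩
        refine ⟨by simp [h4], by simpa using h1, ?_, ?_, by simpa using h8⟩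
        · rintro (_ | i) z z' hz hz'
          · simp at hz hz'
            subst hz
            exact h5 z' (by simpa using hz')
          · exact h6 i z z' (by simpa using hz) (by simpa using hz')
        · rintro (_ | i) z z' hz hz'
          · simp at hz hz'
            subst hz hz'
            exact ⟨h2, h3⟩
          · exact h7 i z z' (by simpa using hz) (by simpa using hz')
      · rintro ⟨h4, h5, h6, h7, h8⟩
        refine ⟨h5 y (by simp), (h7 0 x y (by simp) (by simp)).1,
          (h7 0 x y (by simp) (by simp)).2, by simpa using h4, ?_, ?_, ?_, by simpa using h8⟩
        · intro z hz
          exact h6 0 y z (by simp) (by simpa using hz)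
        · intro i z z' hz hz'
          exact h6 (i + 1) z z' (by simpa using hz) (by simpa using hz')
        · intro i z z' hz hz'
          exact h7 (i + 1) z z' (by simpa using hz) (by simpa using hz')

def G [Fintype B] (D : Dom A B) : RationalGraph A (B × B) := ⟨D.T⟩

theorem G_sync [Fintype B] (D : Dom A B) : D.G.Synchronized := by
  intro a q ls h
  exact D.sync_aux a ls none q h

theorem G_fin [Fintype A] [Fintype B] (D : Dom A B) : D.G.FiniteOutDegree := by
  intro u
  have h : ((Set.univ : Set A) ×ˢ {l : List (B × B) | l.length = u.length + 1}).Finite :=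
    Set.finite_univ.prod (List.finite_length_eq _ _)
  refine h.subset ?_
  rintro ⟨a, v⟩ hv
  have := (D.run_iff a u none v).1 ((D.accepts_iff a u v).1 hv)
  exact ⟨trivial, this.1⟩

/-- Final vertices. -/
def Fin' (D : Dom A B) : Set (List (B × B)) :=
  {u | u ≠ [] ∧ ∀ y ∈ u, D.R y.1 ∧ D.Bot y.2}

open Classical in
noncomputable def M (D : Dom A B) : DFA (B × B) (Bool × Bool) where
  step s y := (true, s.2 && decide (D.R y.1 ∧ D.Bot y.2))
  start := (false, true)
  accept := {(true, true)}

open Classical in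
theorem M_eval (D : Dom A B) (u : List (B × B)) : ∀ s,
    D.M.evalFrom s u = (s.1 || !u.isEmpty, s.2 && decide (∀ y ∈ u, D.R y.1 ∧ D.Bot y.2)) := by
  induction u with
  | nil => intro s; simp
  | cons x u ih =>
    intro s
    rw [DFA.evalFrom_cons, ih]
    simp [M, Bool.and_assoc]

theorem Fin'_reg (D : Dom A B) : Regular D.Fin' := by
  refine ⟨Bool × Bool, inferInstance, D.M, ?_⟩
  ext u
  rw [DFA.mem_accepts, DFA.eval, M_eval]
  simp [M, Fin']
  exact Iff.rfl

/-- Triangular form. -/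
def Tri (D : Dom A B) (w : List A) (x : ℕ → ℕ → B × B) : Prop :=
  (∀ k a, w[k]? = some a → D.Top a (x k 0).1 ∧ D.L (x k 0).2) ∧
  (∀ k i, k < w.length → i < k →
    D.V (x k i).1 (x k (i + 1)).1 ∧ D.H (x k i).2 (x k (i + 1)).2) ∧
  (∀ k i, k + 1 < w.length → i ≤ k →
    D.H (x k i).1 (x (k + 1) i).1 ∧ D.V (x k i).2 (x (k + 1) i).2) ∧
  (∀ k, k < w.length → (x k k).1 = (x k k).2) ∧
  (∀ i, i < w.length → D.R (x (w.length - 1) i).1 ∧ D.Bot (x (w.length - 1) i).2)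

theorem lang_iff_tri (D : Dom A B) (w : List A) :
    w ∈ D.Lang ↔ 0 < w.length ∧ ∃ x, D.Tri w x := by
  refine and_congr_right fun hw => ?_
  constructor
  · rintro ⟨g, hH, hV, hL, hR, hB, hT⟩
    refine ⟨fun k i => (g i k, g k i), ?_, ?_, ?_, ?_, ?_⟩
    · intro k a h
      have := (List.getElem?_eq_some_iff.1 h).1
      exact ⟨hT k a h, hL k this⟩
    · intro k i hk hi
      exact ⟨hV i k (by omega) hk, hH k i hk (by omega)⟩
    · intro k i hk hi
      exact ⟨hH i k (by omega) hk, hV k i hk (by omega)⟩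
    · intro k _; rfl
    · intro i hi
      exact ⟨hR i hi, hB i hi⟩
  · rintro ⟨x, h1, h2, h3, h4, h5⟩
    refine ⟨fun i j => if i ≤ j then (x j i).1 else (x i j).2, ?_, ?_, ?_, ?_, ?_, ?_⟩
    · intro i j hi hj
      dsimp only
      by_cases h : i ≤ j
      · rw [if_pos h, if_pos (by omega)]
        exact (h3 j i hj h).1
      · rw [if_neg h]
        by_cases h' : i = j + 1
        · subst h'
          rw [if_pos le_rfl, h4 _ hi]
          exact (h2 _ j hi (by omega)).2
        · rw [if_neg (by omega)]
          exact (h2 _ j hi (by omega)).2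
    · intro i j hi hj
      dsimp only
      by_cases h : i < j
      · rw [if_pos h.le, if_pos (by omega)]
        exact (h2 j i hj h).1
      · rw [if_neg (by omega : ¬ i + 1 ≤ j)]
        by_cases h' : i = j
        · subst h'
          rw [if_pos le_rfl, h4 _ hj]
          exact (h3 i i hi le_rfl).2
        · rw [if_neg (by omega)]
          exact (h3 i j hi (by omega)).2
    · intro i hi
      obtain ⟨a, ha⟩ : ∃ a, w[i]? = some a := ⟨w[i], List.getElem?_eq_getElem hi⟩
      have := (h1 i a ha).2
      dsimp only
      split_ifs with h
      · obtain rfl : i = 0 := by omega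
        rw [h4 _ hi]; exact this
      · exact this
    · intro i hi
      dsimp only
      rw [if_pos (by omega)]
      exact (h5 i hi).1
    · intro i hi
      dsimp only
      split_ifs with h
      · obtain rfl : i = w.length - 1 := by omega
        rw [h4 _ hi]; exact (h5 _ hi).2
      · exact (h5 i hi).2
    · intro j a h
      dsimp only
      rw [if_pos (by omega)]
      exact (h1 j a h).1

theorem G_lang [Fintype B] (D : Dom A B) : D.G.Lang {[]} D.Fin' = D.Lang := by
  ext w
  rw [lang_iff_tri]
  constructor
  · rintro ⟨vs, i, f, ⟨hlen, hp⟩, hi, hi', hf, hf', hf''⟩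
    obtain rfl : i = [] := hi'
    have hE : ∀ k a u v, w[k]? = some a → vs[k]? = some u → vs[k+1]? = some v →
        D.Run a none u v := fun k a u v h1 h2 h3 => (D.accepts_iff a u v).1 (hp k a u v h1 h2 h3)
    have hvl : ∀ k, k ≤ w.length → ∃ v, vs[k]? = some v ∧ v.length = k := by
      intro k
      induction k with
      | zero =>
        intro _
        exact ⟨[], by rw [← hi, List.head?_eq_getElem?], rfl⟩
      | succ k ih =>
        intro hk
        obtain ⟨u, hu, hul⟩ := ih (by omega)
        have h1 : vs[k+1]? = some vs[k+1] := List.getElem?_eq_getElem (by omega)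
        refine ⟨_, h1, ?_⟩
        have := (D.run_iff _ _ _ _).1
          (hE k (w[k]) u _ (List.getElem?_eq_getElem (by omega)) hu h1)
        rw [this.1, hul]
    have hfl : vs[w.length]? = some f := by
      rw [← hf, List.getLast?_eq_getElem?, hlen]; rfl
    have hfl' : f.length = w.length := by
      obtain ⟨v, hv, hv'⟩ := hvl _ le_rfl
      rw [hfl] at hv
      cases hv; exact hv'
    have hw : 0 < w.length := by
      rw [← hfl']; exact List.length_pos_iff.2 hf'
    refine ⟨hw, ?_⟩
    obtain ⟨b⟩ : Nonempty (B × B) := ⟨f[0]'(by omega)⟩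
    let x : ℕ → ℕ → B × B := fun k i => ((vs[k+1]?.getD [])[i]?).getD b
    have hx : ∀ k v, vs[k+1]? = some v → ∀ i, i < v.length → v[i]? = some (x k i) := by
      intro k v hv i hi
      simp [x, hv, hi]
    refine ⟨x, ?_, ?_, ?_, ?_, ?_⟩
    · intro k a ha
      have hk := (List.getElem?_eq_some_iff.1 ha).1
      obtain ⟨u, hu, hul⟩ := hvl k (by omega)
      obtain ⟨v, hv, hvl⟩ := hvl (k + 1) (by omega)
      have := (D.run_iff _ _ _ _).1 (hE k a u v ha hu hv)
      exact this.2.1 _ (hx k v hv 0 (by omega))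
    · intro k i hk hi
      have ha : w[k]? = some w[k] := List.getElem?_eq_getElem hk
      obtain ⟨u, hu, hul⟩ := hvl k (by omega)
      obtain ⟨v, hv, hvl⟩ := hvl (k + 1) (by omega)
      have := (D.run_iff _ _ _ _).1 (hE k _ u v ha hu hv)
      exact this.2.2.1 i _ _ (hx k v hv i (by omega)) (hx k v hv (i + 1) (by omega))
    · intro k i hk hi
      have ha : w[k+1]? = some w[k+1] := List.getElem?_eq_getElem hk
      obtain ⟨u, hu, hul⟩ := hvl (k + 1) (by omega)
      obtain ⟨v, hv, hvl⟩ := hvl (k + 1 + 1) (by omega)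
      have := (D.run_iff _ _ _ _).1 (hE (k + 1) _ u v ha hu hv)
      exact this.2.2.2.1 i _ _ (hx k u hu i (by omega)) (hx (k + 1) v hv i (by omega))
    · intro k hk
      have ha : w[k]? = some w[k] := List.getElem?_eq_getElem hk
      obtain ⟨u, hu, hul⟩ := hvl k (by omega)
      obtain ⟨v, hv, hvl⟩ := hvl (k + 1) (by omega)
      have := (D.run_iff _ _ _ _).1 (hE k _ u v ha hu hv)
      exact this.2.2.2.2 _ (by rw [hul]; exact hx k v hv k (by omega))
    · intro i hi
      have h := hx (w.length - 1) f (by rw [← hfl]; congr; omega) i (by omega)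
      exact hf'' _ (List.mem_of_getElem? h)
  · rintro ⟨hw, x, h1, h2, h3, h4, h5⟩
    let vx : ℕ → List (B × B) := fun k => (List.range k).map (x (k - 1))
    have hvx : ∀ k i y, (vx k)[i]? = some y ↔ i < k ∧ y = x (k - 1) i := by
      intro k i y
      simp only [vx, List.getElem?_map, Option.map_eq_some_iff,
        List.getElem?_eq_some_iff]
      constructor
      · rintro ⟨z, ⟨hz, rfl⟩, rfl⟩; simp at hz ⊢; exact hz
      · rintro ⟨h, rfl⟩; exact ⟨i, ⟨by simpa using h, by simp⟩, rfl⟩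
    have hvs : ∀ k u, ((List.range (w.length + 1)).map vx)[k]? = some u → u = vx k := by
      intro k u
      simp only [List.getElem?_map, Option.map_eq_some_iff, List.getElem?_eq_some_iff]
      rintro ⟨z, ⟨hz, rfl⟩, rfl⟩; simp
    refine ⟨(List.range (w.length + 1)).map vx, [], vx w.length, ⟨by simp, ?_⟩, ?_, rfl, ?_, ?_, ?_⟩
    · intro k a u v ha hu hv
      have hk := (List.getElem?_eq_some_iff.1 ha).1
      obtain rfl := hvs _ _ hu
      obtain rfl := hvs _ _ hv
      refine (D.accepts_iff _ _ _).2 ((D.run_iff _ _ _ _).2 ⟨by simp [vx], ?_, ?_, ?_, ?_⟩)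
      · intro y hy
        obtain ⟨_, rfl⟩ := (hvx _ _ _).1 hy
        exact h1 k a ha
      · intro i y y' hy hy'
        obtain ⟨_, rfl⟩ := (hvx _ _ _).1 hy
        obtain ⟨_, rfl⟩ := (hvx _ _ _).1 hy'
        exact h2 k i hk (by omega)
      · intro i y y' hy hy'
        obtain ⟨hi, rfl⟩ := (hvx _ _ _).1 hy
        obtain ⟨_, rfl⟩ := (hvx _ _ _).1 hy'
        obtain ⟨k, rfl⟩ : ∃ k', k = k' + 1 := ⟨k - 1, by omega⟩
        exact h3 k i hk (by omega)
      · intro y hy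
        obtain ⟨_, rfl⟩ := (hvx _ _ _).1 hy
        have : (vx k).length = k := by simp [vx]
        rw [this]
        exact h4 k hk
    · simp [List.range_succ_eq_map, vx]
    · simp [List.range_succ]
    · intro h
      have := congrArg List.length h
      simp [vx] at this
      simp [this] at hw
    · intro y hy
      obtain ⟨i, hi⟩ := List.mem_iff_getElem?.1 hy
      obtain ⟨hlt, rfl⟩ := (hvx _ _ _).1 hi
      exact h5 i hlt

end Dom

/-- Entries of the framed picture. -/
def fent {Λ : Type} (rows : List (List Λ)) : ℕ → ℕ → Option Λ
  | 0, _ => none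
  | _ + 1, 0 => none
  | i + 1, j + 1 => rows[i]?.bind fun r => r[j]?

theorem framed_row {Λ : Type} (rows : List (List Λ)) (m : ℕ) (hm : ∀ r ∈ rows, r.length = m)
    (i : ℕ) (hi : i ≤ rows.length + 1) :
    ∃ r, (framed rows m)[i]? = some r ∧ r.length = m + 2 ∧
      ∀ j, j ≤ m + 1 → r[j]? = some (fent rows i j) := by
  rcases i with _ | i
  · refine ⟨List.replicate (m + 2) none, by simp [framed], by simp, ?_⟩
    intro j hj
    rw [List.getElem?_replicate, if_pos (by omega)]; rfl
  · rcases Nat.lt_or_ge i rows.length with h | h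
    · have hl := hm _ (List.getElem_mem h)
      refine ⟨none :: (rows[i].map some ++ [none]), ?_, by simp [hl], ?_⟩
      · simp [framed, List.getElem?_append, h]
      · rintro (_ | j) hj
        · rfl
        · rcases Nat.lt_or_ge j m with h' | h'
          · simp [fent, h, List.getElem?_append, hl, h']
          · obtain rfl : j = m := by omega
            simp [fent, h, List.getElem?_append, hl]
    · obtain rfl : i = rows.length := by omega
      refine ⟨List.replicate (m + 2) none, by simp [framed], by simp, ?_⟩
      intro j hj
      rw [List.getElem?_replicate, if_pos (by omega)]
      cases j <;> simp [fent]

theorem tiles_framed {Λ : Type} (rows : List (List Λ)) (m : ℕ) (hm : ∀ r ∈ rows, r.length = m)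
    (T : Set (Tile (Option Λ))) : tilesOf (framed rows m) ⊆ T ↔
      ∀ i j, i ≤ rows.length → j ≤ m →
        (⟨fent rows i j, fent rows i (j + 1), fent rows (i + 1) j, fent rows (i + 1) (j + 1)⟩ :
          Tile (Option Λ)) ∈ T := by
  constructor
  · intro h i j hi hj
    obtain ⟨r, h1, h2, h3⟩ := framed_row rows m hm i (by omega)
    obtain ⟨r', h1', h2', h3'⟩ := framed_row rows m hm (i + 1) (by omega)
    exact h ⟨i, j, r, r', h1, h1', h3 _ (by omega), h3 _ (by omega), h3' _ (by omega),
      h3' _ (by omega)⟩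
  · rintro h ⟨t1, t2, t3, t4⟩ ⟨i, j, r, r', h1, h2, h3, h4, h5, h6⟩
    have hi : i + 1 < (framed rows m).length := (List.getElem?_eq_some_iff.1 h2).1
    simp [framed] at hi
    obtain ⟨s, g1, g2, g3⟩ := framed_row rows m hm i (by omega)
    obtain ⟨s', g1', g2', g3'⟩ := framed_row rows m hm (i + 1) (by omega)
    obtain rfl : r = s := by rw [h1] at g1; exact Option.some.inj g1
    obtain rfl : r' = s' := by rw [h2] at g1'; exact Option.some.inj g1'
    have hj := (List.getElem?_eq_some_iff.1 h4).1
    dsimp only at h3 h4 h5 h6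
    rw [g3 _ (by omega)] at h3 h4
    rw [g3' _ (by omega)] at h5 h6
    cases h3; cases h4; cases h5; cases h6
    exact h i j (by omega) (by omega)

namespace TilingSystem

variable {A Λ : Type}

/-- Relaxed tile condition. -/
def ok (S : TilingSystem A Λ) (a b c d : Option Λ) : Prop :=
  (⟨a, b, c, d⟩ : Tile (Option Λ)) ∈ S.tiles ∨ (a = none ∧ b = none ∧ c = none ∧ d = none)

def colOK (S : TilingSystem A Λ) {c : ℕ} (x y : Fin (c + 2) → Option Λ) : Prop :=
  ∀ r : Fin (c + 1), S.ok (x r.castSucc) (y r.castSucc) (x r.succ) (y r.succ)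

/-- The domino system with blocks of `c + 2` vertically adjacent cells. -/
def dom (S : TilingSystem A Λ) (c : ℕ) : Dom A (Fin (c + 2) → Option Λ) where
  H x y := S.colOK x y ∧ ∀ r, x r = none ↔ y r = none
  V x y := x (Fin.last _) = y 0
  L x := S.colOK (fun _ => none) x
  R x := S.colOK x (fun _ => none)
  Bot x := x (Fin.last _) = none
  Top a x := x 0 = none ∧ x 1 = some (S.emb a)

theorem dom_of_lang (S : TilingSystem A Λ) (c : ℕ) (w : List A) (rows : List (List Λ)) (n : ℕ)
    (hp : S.Pic rows n w.length) (hh : rows.head? = some (w.map S.emb)) (hn : n ≤ c * w.length) :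
    w ∈ (S.dom c).Lang := by
  obtain ⟨hn0, hm0, rfl, hm, ht⟩ := hp
  rw [tiles_framed rows _ hm] at ht
  have hzero : ∀ i j, rows.length < i → fent rows i j = none := by
    intro i j h
    rcases i with _ | i
    · omega
    · rcases j with _ | j
      · rfl
      · simp [fent, List.getElem?_eq_none (by omega : rows.length ≤ i)]
  have hright : ∀ i, fent rows i (w.length + 1) = none := by
    rintro (_ | i)
    · rfl
    · simp only [fent]
      rcases h : rows[i]? with _ | r
      · rfl
      · have := hm r (List.mem_of_getElem? h)
        simp [← this]
  have hleft : ∀ i, fent rows i 0 = none := by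
    rintro (_ | i) <;> rfl
  have hok : ∀ i j, j ≤ w.length → S.ok (fent rows i j) (fent rows i (j + 1))
      (fent rows (i + 1) j) (fent rows (i + 1) (j + 1)) := by
    intro i j hj
    rcases Nat.lt_or_ge rows.length i with h | h
    · right
      exact ⟨hzero _ _ h, hzero _ _ h, hzero _ _ (by omega), hzero _ _ (by omega)⟩
    · exact Or.inl (ht i j h hj)
  have hshape : ∀ i j, j < w.length →
      (fent rows i (j + 1) = none ↔ i = 0 ∨ rows.length < i) := by
    intro i j hj
    rcases i with _ | i
    · simp [fent]
    · simp only [fent]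
      rcases h : rows[i]? with _ | r
      · have := List.getElem?_eq_none_iff.1 h
        simp; omega
      · have h1 := hm r (List.mem_of_getElem? h)
        have h2 := (List.getElem?_eq_some_iff.1 h).1
        simp [h1]; omega
  refine ⟨hm0, fun I j r => fent rows ((c + 1) * I + r) (j + 1), ?_, ?_, ?_, ?_, ?_, ?_⟩
  · intro I j hI hj
    refine ⟨fun r => ?_, fun r => ?_⟩
    · exact hok _ _ (by omega)
    · dsimp only
      rw [hshape _ _ (by omega), hshape _ _ (by omega)]
  · intro I j hI hj
    simp [dom]
    congr 1
  · intro I hI r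
    have := hok ((c + 1) * I + r) 0 (by omega)
    rw [hleft, hleft] at this
    exact this
  · intro I hI r
    have := hok ((c + 1) * I + r) w.length (by omega)
    rw [hright, hright] at this
    have e : w.length - 1 + 1 = w.length := by omega
    dsimp only
    rw [e]
    exact this
  · intro j hj
    refine hzero _ _ ?_
    obtain ⟨m, hm⟩ : ∃ m, w.length = m + 1 := ⟨w.length - 1, by omega⟩
    rw [hm] at hn ⊢
    simp
    nlinarith
  · intro j a ha
    refine ⟨rfl, ?_⟩
    rw [List.head?_eq_getElem?] at hh
    simp [fent, hh, ha]

theorem lang_of_dom (S : TilingSystem A Λ) (c : ℕ) (w : List A)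
    (h : w ∈ (S.dom c).Lang) : w ∈ S.Lang := by
  obtain ⟨hm0, g, hH, hV, hL, hR, hB, hT⟩ := h
  obtain ⟨m, hm⟩ : ∃ m, w.length = m := ⟨_, rfl⟩
  simp only [hm] at hH hV hL hR hB hT hm0
  let f : ℕ → ℕ → Option Λ := fun i j =>
    if i < (c + 1) * m then g (i / (c + 1)) j ⟨i % (c + 1), by
      have : i % (c + 1) < c + 1 := Nat.mod_lt i (Nat.succ_pos c)
      omega⟩ else none
  have hf : ∀ I j (r : Fin (c + 1)), I < m → f ((c + 1) * I + r) j = g I j r.castSucc := by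
    intro I j r hI
    have h1 : (c + 1) * I + r < (c + 1) * m := by
      have := r.2
      calc (c + 1) * I + r < (c + 1) * I + (c + 1) := by omega
        _ = (c + 1) * (I + 1) := by ring
        _ ≤ _ := Nat.mul_le_mul_left _ hI
    have h2 : ((c + 1) * I + r) / (c + 1) = I := by
      rw [Nat.mul_add_div (by omega), Nat.div_eq_of_lt r.2]; rfl
    have h3 : ((c + 1) * I + r) % (c + 1) = r := by
      rw [Nat.mul_add_mod, Nat.mod_eq_of_lt r.2]
    simp only [f, if_pos h1, h2, h3]
    rfl
  have hf' : ∀ I j (r : Fin (c + 2)), I < m → j < m → f ((c + 1) * I + r) j = g I j r := by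
    intro I j r hI hj
    refine Fin.lastCases ?_ (fun r => ?_) r
    · rcases Nat.lt_or_ge (I + 1) m with h | h
      · have e := hf (I + 1) j 0 h
        have e2 : g I j (Fin.last _) = g (I + 1) j 0 := hV I j h hj
        rw [e2]
        simpa [mul_add] using e
      · obtain rfl : m = I + 1 := by omega
        have : g I j (Fin.last _) = none := hB j hj
        rw [this]
        simp only [f]
        rw [if_neg (by simp [mul_add])]
    · exact hf I j r hI
  have hdec : ∀ i, i < (c + 1) * m → ∃ I, ∃ r : Fin (c + 1), I < m ∧ i = (c + 1) * I + r := by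
    intro i hi
    refine ⟨i / (c + 1), ⟨i % (c + 1), Nat.mod_lt _ (Nat.succ_pos c)⟩, ?_, ?_⟩
    · exact Nat.div_lt_of_lt_mul hi
    · exact (Nat.div_add_mod _ _).symm
  have tH : ∀ i j, i < (c + 1) * m → j + 1 < m →
      S.ok (f i j) (f i (j + 1)) (f (i + 1) j) (f (i + 1) (j + 1)) := by
    intro i j hi hj
    obtain ⟨I, r, hI, rfl⟩ := hdec i hi
    have := (hH I j hI hj).1 r
    rw [← hf' _ _ _ hI (by omega), ← hf' _ _ _ hI (by omega), ← hf' _ _ _ hI (by omega),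
      ← hf' _ _ _ hI (by omega)] at this
    exact this
  have tS : ∀ i j, i < (c + 1) * m → j + 1 < m → (f i j = none ↔ f i (j + 1) = none) := by
    intro i j hi hj
    obtain ⟨I, r, hI, rfl⟩ := hdec i hi
    have := (hH I j hI hj).2 r.castSucc
    rw [← hf' _ _ _ hI (by omega), ← hf' _ _ _ hI (by omega)] at this
    exact this
  have tL : ∀ i, i < (c + 1) * m → S.ok none (f i 0) none (f (i + 1) 0) := by
    intro i hi
    obtain ⟨I, r, hI, rfl⟩ := hdec i hi
    have := (hL I hI) r
    rw [← hf' _ _ _ hI (by omega), ← hf' _ _ _ hI (by omega)] at this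
    exact this
  have tR : ∀ i, i < (c + 1) * m → S.ok (f i (m - 1)) none (f (i + 1) (m - 1)) none := by
    intro i hi
    obtain ⟨I, r, hI, rfl⟩ := hdec i hi
    have := (hR I hI) r
    rw [← hf' _ _ _ hI (by omega), ← hf' _ _ _ hI (by omega)] at this
    exact this
  have tT : ∀ j a, w[j]? = some a → f 0 j = none ∧ f 1 j = some (S.emb a) := by
    intro j a h
    have hj := (List.getElem?_eq_some_iff.1 h).1
    obtain ⟨h1, h2⟩ := hT j a h
    rw [← hf' _ _ _ hm0 (by omega)] at h1 h2
    simpa using And.intro h1 h2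
  have tT' : ∀ j, j < m → f 0 j = none ∧ ∃ b, f 1 j = some b := by
    intro j hj
    obtain ⟨h1, h2⟩ := tT j w[j] (List.getElem?_eq_getElem (by omega))
    exact ⟨h1, _, h2⟩
  have tB : ∀ j, f ((c + 1) * m) j = none := by
    intro j; simp [f]
  clear_value f
  clear hf hf' hdec hH hV hL hR hB hT g
  have hN : 1 ≤ (c + 1) * m := Nat.mul_pos (Nat.succ_pos c) hm0
  -- first `none` row
  have hex : ∃ n, f (n + 2) 0 = none ∧ n + 2 ≤ (c + 1) * m := by
    refine ⟨(c + 1) * m - 2, ?_⟩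
    have : (c + 1) * m ≠ 1 := by
      intro h
      obtain ⟨b, hb⟩ := (tT' 0 hm0).2
      rw [← h, tB] at hb
      cases hb
    have e : (c + 1) * m - 2 + 2 = (c + 1) * m := by omega
    rw [e]
    exact ⟨tB 0, le_rfl⟩
  classical
  obtain ⟨n, ⟨hn1, hn2⟩, hn3⟩ : ∃ n, (f (n + 2) 0 = none ∧ n + 2 ≤ (c + 1) * m) ∧
      ∀ k < n, f (k + 2) 0 ≠ none :=
    ⟨Nat.find hex, Nat.find_spec hex, fun k hk h =>
      Nat.find_min hex hk ⟨h, by have := (Nat.find_spec hex).2; omega⟩⟩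
  have hrow : ∀ i, i ≤ (c + 1) * m → ∀ j, j < m → (f i j = none ↔ f i 0 = none) := by
    intro i hi j
    induction j with
    | zero => intro _; rfl
    | succ j ih =>
      intro hj
      rcases Nat.lt_or_ge i ((c + 1) * m) with h | h
      · rw [← tS i j h hj]; exact ih (by omega)
      · obtain rfl : i = (c + 1) * m := by omega
        simp [tB]
  have hsome : ∀ i, i ≤ n → ∀ j, j < m → ∃ b, f (i + 1) j = some b := by
    intro i hi j hj
    refine Option.ne_none_iff_exists'.1 ?_
    rw [Ne, hrow _ (by omega) _ hj]
    rcases i with _ | i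
    · obtain ⟨b, hb⟩ := (tT' 0 hm0).2
      simp [hb]
    · exact hn3 i (by omega)
  obtain ⟨b0, hb0⟩ := (tT' 0 hm0).2
  let rows : List (List Λ) := (List.range (n + 1)).map fun i =>
    (List.range m).map fun j => (f (i + 1) j).getD b0
  have hlen : rows.length = n + 1 := by simp [rows]
  have hrl : ∀ r ∈ rows, r.length = m := by
    intro r hr
    simp only [rows, List.mem_map] at hr
    obtain ⟨i, _, rfl⟩ := hr
    simp
  have hE : ∀ i j, i ≤ n + 2 → j < m → fent rows i (j + 1) = f i j := by
    intro i j hi hj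
    rcases i with _ | i
    · exact (tT' j hj).1.symm
    · rcases Nat.lt_or_ge i (n + 1) with h | h
      · obtain ⟨b, hb⟩ := hsome i (by omega) j hj
        simp [fent, rows, h, hj, hb]
      · obtain rfl : i = n + 1 := by omega
        have : f (n + 1 + 1) j = none := (hrow _ (by omega) _ hj).2 hn1
        rw [this]
        simp [fent, rows]
  have hE0 : ∀ i, fent rows i 0 = none := by rintro (_ | i) <;> rfl
  have hEm : ∀ i, fent rows i (m + 1) = none := by
    rintro (_ | i)
    · rfl
    · simp only [fent]
      rcases h : rows[i]? with _ | r
      · rfl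
      · have := hrl r (List.mem_of_getElem? h)
        simp [← this]
  have hokE : ∀ i j, i ≤ n + 1 → j ≤ m → S.ok (fent rows i j) (fent rows i (j + 1))
      (fent rows (i + 1) j) (fent rows (i + 1) (j + 1)) := by
    intro i j hi hj
    rcases j with _ | j
    · rw [hE0, hE0, hE _ _ (by omega) hm0, hE _ _ (by omega) hm0]
      exact tL i (by omega)
    · rcases Nat.lt_or_ge (j + 1) m with h | h
      · rw [hE _ _ (by omega) h, hE _ _ (by omega) h, hE _ _ (by omega) (by omega),
          hE _ _ (by omega) (by omega)]
        exact tH i j (by omega) h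
      · obtain rfl : m = j + 1 := by omega
        rw [hEm, hEm, hE _ _ (by omega) (by omega), hE _ _ (by omega) (by omega)]
        exact tR i (by omega)
  have hEs : ∀ i j, i ≤ n → j < m → fent rows (i + 1) (j + 1) ≠ none := by
    intro i j hi hj h
    obtain ⟨b, hb⟩ := hsome i hi j hj
    rw [hE _ _ (by omega) hj, hb] at h
    cases h
  refine ⟨rows, n + 1, ⟨Nat.succ_pos n, by omega, hlen, by rw [hm]; exact hrl, ?_⟩, ?_⟩
  · rw [hm, tiles_framed rows m hrl]
    intro i j hi hj
    rw [hlen] at hi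
    rcases hokE i j hi hj with h | ⟨h1, h2, h3, h4⟩
    · exact h
    · exfalso
      rcases i with _ | i
      · rcases Nat.lt_or_ge j m with h | h
        · exact hEs 0 j (by omega) h h4
        · obtain ⟨j', rfl⟩ : ∃ j', j = j' + 1 := ⟨j - 1, by omega⟩
          exact hEs 0 j' (by omega) (by omega) h3
      · rcases Nat.lt_or_ge j m with h | h
        · exact hEs i j (by omega) h h2
        · obtain ⟨j', rfl⟩ : ∃ j', j = j' + 1 := ⟨j - 1, by omega⟩
          exact hEs i j' (by omega) (by omega) h1
  · simp only [rows, List.range_succ_eq_map, List.map_cons, List.head?_cons]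
    congr 1
    apply List.ext_getElem
    · simp [hm]
    · intro j h1 h2
      have hj : j < w.length := by simpa using h2
      have := (tT j w[j] (List.getElem?_eq_getElem hj)).2
      simp [this]

end TilingSystem


/-- Let `S` be a tiling system with square pictures (there is `c` such
that every `w ∈ L(S)` is the frontier of a picture of `P(S)` of height at most
`c·|w|`). Then there are a synchronized rational graph `H` of finite out-degree, a
single vertex `i` and a rational set `F` with `L(H,{i},F) = L(S)`. -/
theorem square_tiling_to_synchronized_finite_degree {A Λ : Type} [Fintype A] [Fintype Λ]
    (S : TilingSystem A Λ)
    (hsq : ∃ c : ℕ, ∀ w ∈ S.Lang, ∃ (rows : List (List Λ)) (n : ℕ),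
      S.Pic rows n w.length ∧ rows.head? = some (w.map S.emb) ∧ n ≤ c * w.length) :
    ∃ (Γ : Type) (_ : Fintype Γ) (H : RationalGraph A Γ) (i : List Γ)
      (F : Set (List Γ)),
      H.Synchronized ∧ H.FiniteOutDegree ∧ Regular F ∧ H.Lang {i} F = S.Lang := by
  classical
  obtain ⟨c, hc⟩ := hsq
  refine ⟨(Fin (c + 2) → Option Λ) × (Fin (c + 2) → Option Λ), inferInstance, (S.dom c).G, [],
    (S.dom c).Fin', (S.dom c).G_sync, (S.dom c).G_fin, (S.dom c).Fin'_reg, ?_⟩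
  rw [Dom.G_lang]
  ext w
  constructor
  · exact S.lang_of_dom c w
  · intro hw
    obtain ⟨rows, n, h1, h2, h3⟩ := hc w hw
    exact S.dom_of_lang c w rows n h1 h2 h3
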